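/- Fix a straggler probability p ∈ (0,1) and set q := 1 − p, fix constants B > 0, ν > 0, η > 0 and δ ∈ (0,1). Then there exist constants C_l > 0 and n_0 ∈ ℕ (depending only on p, B and δ) such that for every N > n_0 the following holds. Let β_1 < ⋯ < β_N in (−1,1) be decoder points with Δ_max/Δ_min ≤ B, let α_1 < ⋯ < α_K in (−1,1), let x_1, …, x_K ∈ ℝ, let f : ℝ → ℝ be ν-Lipschitz and twice differentiable with |f''| ≤ η, let u_enc : [−1,1] → ℝ be twice continuously differentiable, set g := f ∘ u_enc, and let 0 < λ ≤ N^{−4}. Let B_1, …, B_N be i.i.d. Bernoulli(p) random variables, let F := {n ∈ {1,…,N} : B_n = 0}, and on the event F ≠ ∅ let u_dec be the smoothing-spline minimizer for the nodes {β_v : v ∈ F}, data values g(β_v), and regularization parameter λ. Then with probability at least 1 − δ, F ≠ ∅ and (1/K)·Σ_{k=1}^K (u_dec(α_k) − f(x_k))² ≤ C_l · ((log_{1/p}(qN) + √(1/δ))³ / N³) · ∫_{−1}^{1} (g''(t))² dt + (2ν²/K)·Σ_{k=1}^K (u_enc(α_k) − x_k)². -/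

import Mathlib

open MeasureTheory

/-- The Bernoulli measure on `Bool` giving probability `p` to `true` (straggler). -/
noncomputable def bernoulliMeasure (p : ℝ) : Measure Bool :=
  ENNReal.ofReal p • Measure.dirac true + ENNReal.ofReal (1 - p) • Measure.dirac false

/-- The law of `N` i.i.d. Bernoulli(p) straggler indicators. -/
noncomputable def stragglerMeasure (p : ℝ) (N : ℕ) : Measure (Fin N → Bool) :=
  Measure.pi fun _ => bernoulliMeasure p

/-- The set of non-straggler servers: those `n` with `B_n = 0` (i.e. `ω n = false`). -/
def nonStragglers {N : ℕ} (ω : Fin N → Bool) : Finset (Fin N) :=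
  Finset.univ.filter fun n => ω n = false

/-- Extension of decoder points `β_1 < ⋯ < β_N` (indexed here by `Fin N`, zero-based)
by the sentinels `β_0 := -1` and `β_{N+1} := 1`. -/
noncomputable def extNodes {N : ℕ} (β : Fin N → ℝ) : ℕ → ℝ := fun n =>
  if h : 1 ≤ n ∧ n ≤ N then β ⟨n - 1, by omega⟩ else if n = 0 then -1 else 1

/-- `Δ_max := max_{0 ≤ n ≤ N} (β_{n+1} − β_n)`. -/
noncomputable def dMax {N : ℕ} (β : Fin N → ℝ) : ℝ :=
  sSup ((fun n => extNodes β (n + 1) - extNodes β n) '' Set.Iic N)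

/-- `Δ_min := min_{1 ≤ n ≤ N−1} (β_{n+1} − β_n)`. -/
noncomputable def dMin {N : ℕ} (β : Fin N → ℝ) : ℝ :=
  sInf ((fun n => extNodes β (n + 1) - extNodes β n) '' Set.Icc 1 (N - 1))

/-- The smoothing-spline objective
`J(u) := (1/|F|)·Σ_{v∈F} (u(β_v) − y_v)² + λ·∫_{−1}^{1} (u''(t))² dt`. -/
noncomputable def splineLoss {N : ℕ} (F : Finset (Fin N)) (β y : Fin N → ℝ) (lam : ℝ)
    (u : ℝ → ℝ) : ℝ :=
  (1 / (F.card : ℝ)) * ∑ v ∈ F, (u (β v) - y v) ^ 2 +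
    lam * ∫ t in Set.Icc (-1 : ℝ) 1, (iteratedDerivWithin 2 u (Set.Icc (-1 : ℝ) 1) t) ^ 2

/-- Admissible competitors: twice continuously differentiable on `[−1,1]`
with square-integrable second derivative. -/
def SplineAdmissible (u : ℝ → ℝ) : Prop :=
  ContDiffOn ℝ 2 u (Set.Icc (-1 : ℝ) 1) ∧
    MeasureTheory.IntegrableOn
      (fun t => (iteratedDerivWithin 2 u (Set.Icc (-1 : ℝ) 1) t) ^ 2) (Set.Icc (-1 : ℝ) 1)

/-- `u` is a smoothing-spline minimizer for nodes `{β_v : v ∈ F}`, data `y_v`, parameter `λ`. -/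
def IsSmoothingSpline {N : ℕ} (F : Finset (Fin N)) (β y : Fin N → ℝ) (lam : ℝ)
    (u : ℝ → ℝ) : Prop :=
  SplineAdmissible u ∧ ∀ w, SplineAdmissible w → splineLoss F β y lam u ≤ splineLoss F β y lam w

/-- `u` has successive derivatives `u1` and `u2` on `[-1, 1]`, and `u2` is square-integrable. -/
structure HasSqIntegrableSecondDeriv (u u1 u2 : ℝ → ℝ) : Prop where
  fst : ∀ t ∈ Set.Icc (-1 : ℝ) 1, HasDerivWithinAt u (u1 t) (Set.Icc (-1 : ℝ) 1) t
  snd : ∀ t ∈ Set.Icc (-1 : ℝ) 1, HasDerivWithinAt u1 (u2 t) (Set.Icc (-1 : ℝ) 1) t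
  memLp : MemLp u2 2 (volume.restrict (Set.Icc (-1 : ℝ) 1))

theorem uniqueDiffOn_Icc_neg_one_one : UniqueDiffOn ℝ (Set.Icc (-1 : ℝ) 1) :=
  uniqueDiffOn_Icc (by norm_num)

namespace HasSqIntegrableSecondDeriv

variable {u u1 u2 v v1 v2 : ℝ → ℝ}

theorem sub (hu : HasSqIntegrableSecondDeriv u u1 u2) (hv : HasSqIntegrableSecondDeriv v v1 v2) :
    HasSqIntegrableSecondDeriv (fun t => u t - v t) (fun t => u1 t - v1 t)
      (fun t => u2 t - v2 t) where
  fst t ht := (hu.fst t ht).sub (hv.fst t ht)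
  snd t ht := (hu.snd t ht).sub (hv.snd t ht)
  memLp := hu.memLp.sub hv.memLp

theorem iteratedDerivWithin_eqOn (hu : HasSqIntegrableSecondDeriv u u1 u2) :
    Set.EqOn (iteratedDerivWithin 2 u (Set.Icc (-1 : ℝ) 1)) u2 (Set.Icc (-1 : ℝ) 1) := by
  intro t ht
  have h1 : Set.EqOn (iteratedDerivWithin 1 u (Set.Icc (-1 : ℝ) 1)) u1 (Set.Icc (-1 : ℝ) 1) := by
    intro s hs
    rw [iteratedDerivWithin_one]
    exact (hu.fst s hs).derivWithin (uniqueDiffOn_Icc_neg_one_one s hs)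
  rw [iteratedDerivWithin_succ, derivWithin_congr h1 (h1 ht)]
  exact (hu.snd t ht).derivWithin (uniqueDiffOn_Icc_neg_one_one t ht)

theorem setIntegral_iteratedDerivWithin_sq (hu : HasSqIntegrableSecondDeriv u u1 u2) :
    ∫ t in Set.Icc (-1 : ℝ) 1, (iteratedDerivWithin 2 u (Set.Icc (-1 : ℝ) 1) t) ^ 2 =
      ∫ t in Set.Icc (-1 : ℝ) 1, u2 t ^ 2 :=
  setIntegral_congr_fun measurableSet_Icc fun t ht => by
    simp only [hu.iteratedDerivWithin_eqOn ht]

theorem of_contDiffOn (hu : ContDiffOn ℝ 2 u (Set.Icc (-1 : ℝ) 1)) :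
    HasSqIntegrableSecondDeriv u (derivWithin u (Set.Icc (-1 : ℝ) 1))
      (iteratedDerivWithin 2 u (Set.Icc (-1 : ℝ) 1)) where
  fst t ht := ((hu.differentiableOn (by norm_num)) t ht).hasDerivWithinAt
  snd t ht := by
    have h := hu.differentiableOn_iteratedDerivWithin (m := 1) (by norm_num)
      uniqueDiffOn_Icc_neg_one_one
    rw [iteratedDerivWithin_one] at h
    rw [iteratedDerivWithin_succ, iteratedDerivWithin_one]
    exact (h t ht).hasDerivWithinAt
  memLp := by
    have h := hu.continuousOn_iteratedDerivWithin (m := 2) le_rfl uniqueDiffOn_Icc_neg_one_one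
    obtain ⟨C, hC⟩ := isCompact_Icc.exists_bound_of_continuousOn h
    exact MemLp.of_bound (h.aestronglyMeasurable measurableSet_Icc) C
      ((ae_restrict_iff' measurableSet_Icc).2 (Filter.Eventually.of_forall hC))

theorem comp {f : ℝ → ℝ} (hu : ContDiffOn ℝ 2 u (Set.Icc (-1 : ℝ) 1))
    (hf : ∀ t, DifferentiableAt ℝ f t) (hf' : ∀ t, DifferentiableAt ℝ (deriv f) t)
    {η : ℝ} (hη : ∀ t, |deriv (deriv f) t| ≤ η) :
    ∃ g1 g2, HasSqIntegrableSecondDeriv (fun t => f (u t)) g1 g2 := by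
  have hu' := of_contDiffOn hu
  set S := Set.Icc (-1 : ℝ) 1
  set u1 := derivWithin u S
  set u2 := iteratedDerivWithin 2 u S
  have hc1 : ContinuousOn u1 S := fun t ht => (hu'.snd t ht).continuousWithinAt
  have hc2 : ContinuousOn u2 S :=
    hu.continuousOn_iteratedDerivWithin (m := 2) le_rfl uniqueDiffOn_Icc_neg_one_one
  have hcf : ContinuousOn (fun t => deriv f (u t)) S :=
    (continuous_iff_continuousAt.2 fun t => (hf' t).continuousAt).comp_continuousOn hu.continuousOn
  refine ⟨fun t => deriv f (u t) * u1 t,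
    fun t => deriv (deriv f) (u t) * u1 t * u1 t + deriv f (u t) * u2 t, ?_, ?_, ?_⟩
  · intro t ht
    exact (hf (u t)).hasDerivAt.comp_hasDerivWithinAt t (hu'.fst t ht)
  · intro t ht
    exact ((hf' (u t)).hasDerivAt.comp_hasDerivWithinAt t (hu'.fst t ht)).mul (hu'.snd t ht)
  · obtain ⟨C1, hC1⟩ := isCompact_Icc.exists_bound_of_continuousOn (s := S) (hc1.mul hc1)
    obtain ⟨C2, hC2⟩ := isCompact_Icc.exists_bound_of_continuousOn (s := S) (hcf.mul hc2)
    have hm1 : AEStronglyMeasurable u1 (volume.restrict S) :=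
      hc1.aestronglyMeasurable measurableSet_Icc
    have hmu : AEMeasurable u (volume.restrict S) :=
      (hu.continuousOn.aestronglyMeasurable measurableSet_Icc).aemeasurable
    have hmf : AEStronglyMeasurable (fun t => deriv (deriv f) (u t)) (volume.restrict S) :=
      ((measurable_deriv (deriv f)).comp_aemeasurable hmu).aestronglyMeasurable
    refine MemLp.of_bound (((hmf.mul hm1).mul hm1).add
      ((hcf.mul hc2).aestronglyMeasurable measurableSet_Icc)) (η * C1 + C2)
      ((ae_restrict_iff' measurableSet_Icc).2 (Filter.Eventually.of_forall fun t ht => ?_))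
    refine (norm_add_le _ _).trans (add_le_add ?_ (hC2 t ht))
    rw [mul_assoc, norm_mul]
    exact mul_le_mul (hη _) (hC1 t ht) (norm_nonneg _) ((abs_nonneg _).trans (hη 0))

theorem sq_deriv_sub_le {s t : ℝ} (hu : HasSqIntegrableSecondDeriv u u1 u2) (hs : -1 ≤ s)
    (hst : s ≤ t) (ht : t ≤ 1) :
    (u1 t - u1 s) ^ 2 ≤ (t - s) * ∫ x in Set.Icc (-1 : ℝ) 1, u2 x ^ 2 := by
  have hsub : Set.Icc s t ⊆ Set.Icc (-1 : ℝ) 1 := Set.Icc_subset_Icc hs ht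
  have hi : IntegrableOn u2 (Set.Icc (-1 : ℝ) 1) := hu.memLp.integrable (by norm_num)
  have hi2 : IntegrableOn (fun x => u2 x ^ 2) (Set.Icc (-1 : ℝ) 1) := hu.memLp.integrable_sq
  have hii : IntervalIntegrable u2 volume s t :=
    ((intervalIntegrable_iff_integrableOn_Icc_of_le hst).2 (hi.mono_set hsub))
  have hii2 : IntervalIntegrable (fun x => u2 x ^ 2) volume s t :=
    ((intervalIntegrable_iff_integrableOn_Icc_of_le hst).2 (hi2.mono_set hsub))
  have hftc : ∫ x in s..t, u2 x = u1 t - u1 s := by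
    refine intervalIntegral.integral_eq_sub_of_hasDerivAt_of_le hst ?_ ?_ hii
    · exact fun x hx => ((hu.snd x (hsub hx)).continuousWithinAt).mono hsub
    · intro x hx
      exact (hu.snd x (hsub (Set.Ioo_subset_Icc_self hx))).hasDerivAt
        (Icc_mem_nhds (by linarith [hx.1]) (by linarith [hx.2]))
  have hle : ∫ x in s..t, u2 x ^ 2 ≤ ∫ x in Set.Icc (-1 : ℝ) 1, u2 x ^ 2 := by
    rw [intervalIntegral.integral_of_le hst, ← integral_Icc_eq_integral_Ioc]
    exact setIntegral_mono_set hi2 (Filter.Eventually.of_forall fun x => sq_nonneg _)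
      hsub.eventuallyLE
  rcases hst.eq_or_lt with rfl | hlt
  · simp
  set c := (u1 t - u1 s) / (t - s) with hc
  have hnn : 0 ≤ ∫ x in s..t, (u2 x - c) ^ 2 :=
    intervalIntegral.integral_nonneg hst fun x _ => sq_nonneg _
  have hexp : ∫ x in s..t, (u2 x - c) ^ 2 =
      (∫ x in s..t, u2 x ^ 2) - 2 * c * (u1 t - u1 s) + (t - s) * c ^ 2 := by
    have : (fun x => (u2 x - c) ^ 2) = fun x => u2 x ^ 2 - 2 * c * u2 x + c ^ 2 := by
      funext x; ring
    rw [this, intervalIntegral.integral_add (hii2.sub (hii.const_mul _)) (by simp),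
      intervalIntegral.integral_sub hii2 (hii.const_mul _),
      intervalIntegral.integral_const_mul, hftc, intervalIntegral.integral_const, smul_eq_mul]
  have hpos : 0 < t - s := sub_pos.2 hlt
  have hceq : c * (t - s) = u1 t - u1 s := by rw [hc]; field_simp
  calc (u1 t - u1 s) ^ 2
      = (t - s) * (2 * c * (u1 t - u1 s) - (t - s) * c ^ 2) := by rw [← hceq]; ring
    _ ≤ (t - s) * ∫ x in s..t, u2 x ^ 2 := by
      apply mul_le_mul_of_nonneg_left _ hpos.le; linarith
    _ ≤ _ := mul_le_mul_of_nonneg_left hle hpos.le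

/-- A function that is small at two separated points of an interval is small on the whole
interval, up to its curvature energy. -/
theorem abs_le_of_two_points (hu : HasSqIntegrableSecondDeriv u u1 u2) {P Q a b t X D H d : ℝ}
    (hP : -1 ≤ P) (hQ : Q ≤ 1) (haP : P ≤ a) (hbQ : b ≤ Q) (htP : P ≤ t) (htQ : t ≤ Q)
    (hd : 0 < d) (hdab : d ≤ b - a) (hH : Q - P ≤ H) (ha : |u a| ≤ X) (hb : |u b| ≤ X)
    (hD0 : 0 ≤ D) (hD : H * ∫ x in Set.Icc (-1 : ℝ) 1, u2 x ^ 2 ≤ D ^ 2) :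
    |u t| ≤ X * (1 + 2 * H / d) + 2 * D * H := by
  have hsub : Set.Icc P Q ⊆ Set.Icc (-1 : ℝ) 1 := Set.Icc_subset_Icc hP hQ
  have hE : 0 ≤ ∫ x in Set.Icc (-1 : ℝ) 1, u2 x ^ 2 := integral_nonneg fun x => sq_nonneg _
  have hvar : ∀ x ∈ Set.Icc P Q, ‖u1 x - u1 a‖ ≤ D := by
    intro x hx
    rw [Real.norm_eq_abs]
    apply abs_le_of_sq_le_sq _ hD0
    refine le_trans ?_ hD
    rcases le_total a x with h | h
    · exact (hu.sq_deriv_sub_le (hP.trans haP) h (hx.2.trans hQ)).trans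
        (mul_le_mul_of_nonneg_right (by linarith [hx.2]) hE)
    · rw [← neg_sq, neg_sub]
      exact (hu.sq_deriv_sub_le (hP.trans hx.1) h (by linarith)).trans
        (mul_le_mul_of_nonneg_right (by linarith [hx.1]) hE)
  have hmv : ∀ x ∈ Set.Icc P Q, |u x - u a - u1 a * (x - a)| ≤ D * |x - a| := by
    intro x hx
    have h := (convex_Icc P Q).norm_image_sub_le_of_norm_hasDerivWithin_le
      (f := fun y => u y - u1 a * y) (f' := fun y => u1 y - u1 a) (x := a) (y := x) (C := D)
      (fun y hy => ((hu.fst y (hsub hy)).mono hsub).sub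
        (((hasDerivWithinAt_id y (Set.Icc P Q)).const_mul (u1 a)).congr_deriv (mul_one _)))
      hvar ⟨haP, by linarith⟩ hx
    rw [Real.norm_eq_abs, Real.norm_eq_abs] at h
    refine le_trans (le_of_eq ?_) h
    congr 1; ring
  have hba : 0 < b - a := hd.trans_le hdab
  have hslope : |u1 a| ≤ 2 * X / d + D := by
    have h := hmv b ⟨by linarith, hbQ⟩
    rw [abs_of_pos hba] at h
    have h2 : |u1 a| * (b - a) ≤ 2 * X + D * (b - a) := by
      rw [← abs_of_pos hba, ← abs_mul, abs_of_pos hba]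
      rw [abs_le] at *
      constructor <;> linarith [h.1, h.2, ha.1, ha.2, hb.1, hb.2]
    have hX : 0 ≤ X := (abs_nonneg _).trans ha
    have h3 : |u1 a| ≤ 2 * X / (b - a) + D := by
      rw [← sub_le_iff_le_add, le_div_iff₀ hba]; linarith
    exact h3.trans (by gcongr)
  have hta : |t - a| ≤ H := abs_le.2 ⟨by linarith, by linarith⟩
  have h := hmv t ⟨htP, htQ⟩
  calc |u t| = |(u t - u a - u1 a * (t - a)) + u a + u1 a * (t - a)| := by congr 1; ring
    _ ≤ |u t - u a - u1 a * (t - a)| + |u a| + |u1 a * (t - a)| := abs_add_three _ _ _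
    _ ≤ D * H + X + (2 * X / d + D) * H := by
      rw [abs_mul]
      gcongr
      · exact h.trans (by gcongr)
      · exact (abs_nonneg _).trans hslope
    _ = _ := by ring

end HasSqIntegrableSecondDeriv

namespace HasSqIntegrableSecondDeriv

variable {g g1 g2 : ℝ → ℝ}

theorem sq_le_of_initial_eq_zero {t : ℝ} (hg : HasSqIntegrableSecondDeriv g g1 g2)
    (h0 : g (-1) = 0) (h1 : g1 (-1) = 0) (ht : t ∈ Set.Icc (-1 : ℝ) 1) :
    g t ^ 2 ≤ 8 * ∫ x in Set.Icc (-1 : ℝ) 1, g2 x ^ 2 := by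
  set E := ∫ x in Set.Icc (-1 : ℝ) 1, g2 x ^ 2 with hE
  have hE0 : 0 ≤ E := integral_nonneg fun x => sq_nonneg _
  have hm1 : (-1 : ℝ) ∈ Set.Icc (-1 : ℝ) 1 := by norm_num
  have hb : ∀ x ∈ Set.Icc (-1 : ℝ) 1, ‖g1 x‖ ≤ √(2 * E) := by
    intro x hx
    refine Real.abs_le_sqrt ?_
    have h := hg.sq_deriv_sub_le le_rfl hx.1 hx.2
    rw [h1, sub_zero] at h
    exact h.trans (mul_le_mul_of_nonneg_right (by linarith [hx.2]) hE0)
  have h := (convex_Icc (-1 : ℝ) 1).norm_image_sub_le_of_norm_hasDerivWithin_le hg.fst hb hm1 ht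
  rw [h0, sub_zero, Real.norm_eq_abs, Real.norm_eq_abs,
    abs_of_nonneg (by linarith [ht.1] : (0 : ℝ) ≤ t - -1)] at h
  have h2 : |g t| ≤ √(2 * E) * 2 := h.trans (by gcongr; linarith [ht.2])
  calc g t ^ 2 = |g t| ^ 2 := (sq_abs _).symm
    _ ≤ (√(2 * E) * 2) ^ 2 := by gcongr
    _ = 8 * E := by rw [mul_pow, Real.sq_sqrt (by positivity)]; ring

theorem exists_admissible_approx (hg : HasSqIntegrableSecondDeriv g g1 g2) {ε : ℝ} (hε : 0 < ε) :
    ∃ w w1 w2, SplineAdmissible w ∧ HasSqIntegrableSecondDeriv w w1 w2 ∧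
      (∀ t ∈ Set.Icc (-1 : ℝ) 1, (w t - g t) ^ 2 ≤ 8 * ε) ∧
      ∫ t in Set.Icc (-1 : ℝ) 1, (w2 t - g2 t) ^ 2 ≤ ε := by
  obtain ⟨h, -, hh, hc, -⟩ := MemLp.exists_hasCompactSupport_integral_rpow_sub_le
    (f := g2) (μ := volume.restrict (Set.Icc (-1 : ℝ) 1)) (p := 2) (by norm_num)
    (by simpa using hg.memLp) hε
  have hle : ∫ t in Set.Icc (-1 : ℝ) 1, (h t - g2 t) ^ 2 ≤ ε := by
    refine le_trans (le_of_eq ?_) hh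
    congr 1
    funext t
    rw [Real.rpow_two, Real.norm_eq_abs, sq_abs]
    ring
  let w1 : ℝ → ℝ := fun t => g1 (-1) + ∫ s in (-1 : ℝ)..t, h s
  have hw1 : ∀ t, HasDerivAt w1 (h t) t := fun t =>
    ((hc.integral_hasStrictDerivAt (-1) t).hasDerivAt).const_add _
  have hw1c : Continuous w1 := continuous_iff_continuousAt.2 fun t => (hw1 t).continuousAt
  let w : ℝ → ℝ := fun t => g (-1) + ∫ s in (-1 : ℝ)..t, w1 s
  have hw : ∀ t, HasDerivAt w (w1 t) t := fun t =>
    ((hw1c.integral_hasStrictDerivAt (-1) t).hasDerivAt).const_add _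
  have hdw : deriv w = w1 := funext fun t => (hw t).deriv
  have hdw1 : deriv w1 = h := funext fun t => (hw1 t).deriv
  have hC2 : ContDiff ℝ 2 w := by
    rw [show (2 : WithTop ℕ∞) = 1 + 1 by norm_num, contDiff_succ_iff_deriv]
    refine ⟨fun t => (hw t).differentiableAt, by simp, ?_⟩
    rw [hdw, contDiff_one_iff_deriv, hdw1]
    exact ⟨fun t => (hw1 t).differentiableAt, hc⟩
  have hW : HasSqIntegrableSecondDeriv w w1 h := by
    refine ⟨fun t _ => (hw t).hasDerivWithinAt, fun t _ => (hw1 t).hasDerivWithinAt, ?_⟩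
    obtain ⟨C, hC⟩ := isCompact_Icc.exists_bound_of_continuousOn
      (hc.continuousOn (s := Set.Icc (-1 : ℝ) 1))
    exact MemLp.of_bound (hc.continuousOn.aestronglyMeasurable measurableSet_Icc) C
      ((ae_restrict_iff' measurableSet_Icc).2 (Filter.Eventually.of_forall hC))
  refine ⟨w, w1, h, ⟨hC2.contDiffOn,
    (of_contDiffOn hC2.contDiffOn).memLp.integrable_sq⟩, hW, ?_, hle⟩
  intro t ht
  exact ((hW.sub hg).sq_le_of_initial_eq_zero (by simp [w]) (by simp [w1]) ht).trans (by linarith)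

theorem splineLoss_eq {N : ℕ} (F : Finset (Fin N)) (β y : Fin N → ℝ) (lam : ℝ)
    (hg : HasSqIntegrableSecondDeriv g g1 g2) :
    splineLoss F β y lam g = (1 / (F.card : ℝ)) * ∑ v ∈ F, (g (β v) - y v) ^ 2 +
      lam * ∫ t in Set.Icc (-1 : ℝ) 1, g2 t ^ 2 := by
  rw [splineLoss, hg.setIntegral_iteratedDerivWithin_sq]

/-- Competitors whose second derivative is merely square-integrable do not beat a
smoothing spline fitted to their values. -/
theorem splineLoss_smoothingSpline_le {N : ℕ} {F : Finset (Fin N)} (hF : F.Nonempty)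
    {β : Fin N → ℝ} (hβ : ∀ n, β n ∈ Set.Ioo (-1 : ℝ) 1) {lam : ℝ} (hlam : 0 < lam) {u : ℝ → ℝ}
    (hu : IsSmoothingSpline F β (fun v => g (β v)) lam u)
    (hg : HasSqIntegrableSecondDeriv g g1 g2) :
    splineLoss F β (fun v => g (β v)) lam u ≤ lam * ∫ t in Set.Icc (-1 : ℝ) 1, g2 t ^ 2 := by
  set G := ∫ t in Set.Icc (-1 : ℝ) 1, g2 t ^ 2
  have key : ∀ ε : ℝ, 0 < ε → splineLoss F β (fun v => g (β v)) lam u ≤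
      8 * ε ^ 2 + lam * ((1 + ε) * G + (ε + ε ^ 2)) := by
    intro ε hε
    obtain ⟨w, w1, w2, hadm, hw, hclose, hE⟩ := hg.exists_admissible_approx (pow_pos hε 2)
    refine (hu.2 w hadm).trans ?_
    rw [hw.splineLoss_eq]
    have hcard : (0 : ℝ) < F.card := by exact_mod_cast hF.card_pos
    have hsum : (1 / (F.card : ℝ)) * ∑ v ∈ F, (w (β v) - g (β v)) ^ 2 ≤ 8 * ε ^ 2 := by
      rw [one_div, inv_mul_le_iff₀ hcard, ← nsmul_eq_mul]
      exact Finset.sum_le_card_nsmul _ _ _ fun v _ =>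
        hclose _ (Set.Ioo_subset_Icc_self (hβ v))
    have hd := (hw.sub hg).memLp.integrable_sq
    have hint : ∫ t in Set.Icc (-1 : ℝ) 1, w2 t ^ 2 ≤ (1 + ε) * G + (1 + ε⁻¹) * ε ^ 2 := by
      calc ∫ t in Set.Icc (-1 : ℝ) 1, w2 t ^ 2
          ≤ ∫ t in Set.Icc (-1 : ℝ) 1, ((1 + ε) * g2 t ^ 2 + (1 + ε⁻¹) * (w2 t - g2 t) ^ 2) := by
            refine integral_mono hw.memLp.integrable_sq
              ((hg.memLp.integrable_sq.const_mul _).add (hd.const_mul _)) fun t => ?_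
            have h := mul_nonneg (inv_pos.2 hε).le (sq_nonneg (ε * g2 t - (w2 t - g2 t)))
            have he : (1 + ε) * g2 t ^ 2 + (1 + ε⁻¹) * (w2 t - g2 t) ^ 2 =
                w2 t ^ 2 + ε⁻¹ * (ε * g2 t - (w2 t - g2 t)) ^ 2 := by field_simp; ring
            show w2 t ^ 2 ≤ (1 + ε) * g2 t ^ 2 + (1 + ε⁻¹) * (w2 t - g2 t) ^ 2
            rw [he]
            linarith
        _ = (1 + ε) * G + (1 + ε⁻¹) * ∫ t in Set.Icc (-1 : ℝ) 1, (w2 t - g2 t) ^ 2 := by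
            rw [integral_add (hg.memLp.integrable_sq.const_mul _) (hd.const_mul _),
              integral_const_mul, integral_const_mul]
        _ ≤ _ := by gcongr
    have he : (1 + ε⁻¹) * ε ^ 2 = ε + ε ^ 2 := by field_simp; ring
    rw [he] at hint
    gcongr
  have hlim : Filter.Tendsto (fun ε : ℝ => 8 * ε ^ 2 + lam * ((1 + ε) * G + (ε + ε ^ 2)))
      (nhdsWithin 0 (Set.Ioi 0)) (nhds (lam * G)) := by
    have hc : Continuous fun ε : ℝ => 8 * ε ^ 2 + lam * ((1 + ε) * G + (ε + ε ^ 2)) := by fun_prop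
    simpa using (hc.tendsto 0).mono_left nhdsWithin_le_nhds
  exact ge_of_tendsto hlim (Filter.eventually_of_mem self_mem_nhdsWithin key)

/-- The error of a smoothing spline at the nodes, and its curvature energy. -/
theorem smoothingSpline_error {N : ℕ} {F : Finset (Fin N)} (hF : F.Nonempty)
    {β : Fin N → ℝ} (hβ : ∀ n, β n ∈ Set.Ioo (-1 : ℝ) 1) {lam : ℝ} (hlam : 0 < lam) {u : ℝ → ℝ}
    (hu : IsSmoothingSpline F β (fun v => g (β v)) lam u)
    (hg : HasSqIntegrableSecondDeriv g g1 g2) :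
    (∀ v ∈ F, (u (β v) - g (β v)) ^ 2 ≤
      N * lam * ∫ t in Set.Icc (-1 : ℝ) 1, g2 t ^ 2) ∧
    ∃ e1 e2, HasSqIntegrableSecondDeriv (fun t => u t - g t) e1 e2 ∧
      ∫ t in Set.Icc (-1 : ℝ) 1, e2 t ^ 2 ≤ 4 * ∫ t in Set.Icc (-1 : ℝ) 1, g2 t ^ 2 := by
  have hloss := hg.splineLoss_smoothingSpline_le hF hβ hlam hu
  have hu' := of_contDiffOn hu.1.1
  set u2 := iteratedDerivWithin 2 u (Set.Icc (-1 : ℝ) 1)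
  set G := ∫ t in Set.Icc (-1 : ℝ) 1, g2 t ^ 2
  have hG : 0 ≤ G := integral_nonneg fun x => sq_nonneg _
  rw [hu'.splineLoss_eq] at hloss
  have hU : 0 ≤ ∫ t in Set.Icc (-1 : ℝ) 1, u2 t ^ 2 := integral_nonneg fun x => sq_nonneg _
  have hcard : (0 : ℝ) < F.card := by exact_mod_cast hF.card_pos
  have hcardN : (F.card : ℝ) ≤ N := by exact_mod_cast (card_finset_fin_le F)
  have hS : 0 ≤ ∑ v ∈ F, (u (β v) - g (β v)) ^ 2 := Finset.sum_nonneg fun v _ => sq_nonneg _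
  constructor
  · intro v hv
    have h1 : (1 / (F.card : ℝ)) * ∑ v ∈ F, (u (β v) - g (β v)) ^ 2 ≤ lam * G := by
      linarith [mul_nonneg hlam.le hU]
    rw [one_div, inv_mul_le_iff₀ hcard] at h1
    calc (u (β v) - g (β v)) ^ 2 ≤ ∑ v ∈ F, (u (β v) - g (β v)) ^ 2 :=
          Finset.single_le_sum (f := fun v => (u (β v) - g (β v)) ^ 2)
            (fun v _ => sq_nonneg _) hv
      _ ≤ F.card * (lam * G) := h1
      _ ≤ N * (lam * G) := mul_le_mul_of_nonneg_right hcardN (mul_nonneg hlam.le hG)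
      _ = _ := by ring
  · refine ⟨_, _, hu'.sub hg, ?_⟩
    have hUG : ∫ t in Set.Icc (-1 : ℝ) 1, u2 t ^ 2 ≤ G := by
      have := mul_nonneg (one_div_nonneg.2 hcard.le) hS
      exact le_of_mul_le_mul_left (by linarith) hlam
    calc ∫ t in Set.Icc (-1 : ℝ) 1, (u2 t - g2 t) ^ 2
        ≤ ∫ t in Set.Icc (-1 : ℝ) 1, (2 * u2 t ^ 2 + 2 * g2 t ^ 2) :=
          integral_mono (hu'.sub hg).memLp.integrable_sq
            ((hu'.memLp.integrable_sq.const_mul _).add (hg.memLp.integrable_sq.const_mul _))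
            fun t => by
              show (u2 t - g2 t) ^ 2 ≤ 2 * u2 t ^ 2 + 2 * g2 t ^ 2
              linarith [sq_nonneg (u2 t + g2 t)]
      _ = 2 * (∫ t in Set.Icc (-1 : ℝ) 1, u2 t ^ 2) + 2 * G := by
          rw [integral_add (hu'.memLp.integrable_sq.const_mul _)
            (hg.memLp.integrable_sq.const_mul _), integral_const_mul, integral_const_mul]
      _ ≤ 4 * G := by linarith

end HasSqIntegrableSecondDeriv

section Nodes

variable {N : ℕ} {β : Fin N → ℝ}

theorem extNodes_zero : extNodes β 0 = -1 := by simp [extNodes]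

theorem extNodes_succ_fin (i : Fin N) : extNodes β (i + 1) = β i := by
  have := i.2
  simp [extNodes]

theorem extNodes_of_lt {n : ℕ} (hn : N < n) : extNodes β n = 1 := by
  have h1 : ¬ (1 ≤ n ∧ n ≤ N) := by omega
  have h2 : n ≠ 0 := by omega
  simp [extNodes, h1, h2]

theorem extNodes_lt_succ (hmono : StrictMono β) (hβ : ∀ n, β n ∈ Set.Ioo (-1 : ℝ) 1) {n : ℕ}
    (hn : n ≤ N) : extNodes β n < extNodes β (n + 1) := by
  rcases Nat.eq_zero_or_pos n with rfl | hpos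
  · rw [extNodes_zero]
    rcases Nat.eq_zero_or_pos N with hN | hN
    · rw [extNodes_of_lt (by omega)]; norm_num
    · exact (hβ ⟨0, hN⟩).1.trans_eq (extNodes_succ_fin ⟨0, hN⟩).symm
  · obtain ⟨m, rfl⟩ : ∃ m, n = m + 1 := ⟨n - 1, by omega⟩
    rw [extNodes_succ_fin ⟨m, by omega⟩]
    rcases hn.eq_or_lt with h | h
    · rw [extNodes_of_lt (by omega)]
      exact (hβ _).2
    · rw [extNodes_succ_fin ⟨m + 1, h⟩]
      exact hmono (by simp)

theorem extNodes_mono (hmono : StrictMono β) (hβ : ∀ n, β n ∈ Set.Ioo (-1 : ℝ) 1) :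
    Monotone (extNodes β) := by
  refine monotone_nat_of_le_succ fun n => ?_
  rcases le_or_gt n N with h | h
  · exact (extNodes_lt_succ hmono hβ h).le
  · rw [extNodes_of_lt h, extNodes_of_lt (by omega)]

theorem extNodes_gap_le_dMax {n : ℕ} (hn : n ≤ N) :
    extNodes β (n + 1) - extNodes β n ≤ dMax β :=
  le_csSup ((Set.finite_Iic N).image _).bddAbove ⟨n, hn, rfl⟩

theorem dMin_le_extNodes_gap {n : ℕ} (h1 : 1 ≤ n) (hn : n ≤ N - 1) :
    dMin β ≤ extNodes β (n + 1) - extNodes β n :=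
  csInf_le ((Set.finite_Icc 1 (N - 1)).image _).bddBelow ⟨n, ⟨h1, hn⟩, rfl⟩

theorem dMin_pos (hmono : StrictMono β) (hβ : ∀ n, β n ∈ Set.Ioo (-1 : ℝ) 1) (hN : 2 ≤ N) :
    0 < dMin β := by
  obtain ⟨n, hn, h⟩ := Set.Nonempty.csInf_mem
    (s := (fun n => extNodes β (n + 1) - extNodes β n) '' Set.Icc 1 (N - 1))
    ⟨_, 1, ⟨le_rfl, by omega⟩, rfl⟩ ((Set.finite_Icc 1 (N - 1)).image _)
  have hn' : n ≤ N := hn.2.trans (Nat.sub_le _ _)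
  rw [dMin, ← h]
  exact sub_pos.2 (extNodes_lt_succ hmono hβ hn')

theorem extNodes_add_sub_le (j : ℕ) {k : ℕ} (hk : j + k ≤ N + 1) :
    extNodes β (j + k) - extNodes β j ≤ k * dMax β := by
  induction k with
  | zero => simp
  | succ k ih =>
    have h := extNodes_gap_le_dMax (β := β) (n := j + k) (by omega)
    have := ih (by omega)
    push_cast
    rw [← add_assoc]
    linarith

theorem mul_dMin_le_extNodes_sub {k : ℕ} (hk : k ≤ N - 1) :
    k * dMin β ≤ extNodes β (1 + k) - extNodes β 1 := by
  induction k with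
  | zero => simp
  | succ k ih =>
    have h := dMin_le_extNodes_gap (β := β) (n := 1 + k) (by omega) (by omega)
    have := ih (by omega)
    push_cast
    rw [← add_assoc]
    linarith

theorem dMin_le (hβ : ∀ n, β n ∈ Set.Ioo (-1 : ℝ) 1) (hN : 2 ≤ N) : dMin β ≤ 4 / N := by
  have h := mul_dMin_le_extNodes_sub (β := β) (le_refl (N - 1))
  have e1 : extNodes β 1 = β ⟨0, by omega⟩ := extNodes_succ_fin ⟨0, by omega⟩
  have e2 : extNodes β (1 + (N - 1)) = β ⟨N - 1, by omega⟩ := by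
    rw [add_comm]; exact extNodes_succ_fin ⟨N - 1, by omega⟩
  rw [e1, e2, Nat.cast_sub (by omega), Nat.cast_one] at h
  have h1 := (hβ ⟨0, by omega⟩).1
  have h2 := (hβ ⟨N - 1, by omega⟩).2
  have hN' : (2 : ℝ) ≤ N := by exact_mod_cast hN
  rw [le_div_iff₀ (by linarith)]
  rcases le_total (dMin β) 0 with h0 | h0
  · nlinarith
  · nlinarith

theorem dMin_le_sub (hmono : StrictMono β) (hβ : ∀ n, β n ∈ Set.Ioo (-1 : ℝ) 1) {i j : Fin N}
    (hij : i < j) : dMin β ≤ β j - β i := by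
  have hj := j.2
  have h : (i : ℕ) < j := hij
  have h1 := dMin_le_extNodes_gap (β := β) (n := i + 1) (by omega) (by omega)
  have h2 : extNodes β (i + 1 + 1) ≤ extNodes β (j + 1) := extNodes_mono hmono hβ (by omega)
  rw [extNodes_succ_fin] at h1 h2
  linarith

/-- Every point of `[-1, 1]` lies in a window of consecutive nodes with `m` interior nodes. -/
theorem exists_extNodes_window (hmono : StrictMono β) (hβ : ∀ n, β n ∈ Set.Ioo (-1 : ℝ) 1)
    {m : ℕ} (hm : m ≤ N) {t : ℝ} (ht : t ∈ Set.Icc (-1 : ℝ) 1) :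
    ∃ j, j + m ≤ N ∧ extNodes β j ≤ t ∧ t ≤ extNodes β (j + m + 1) := by
  classical
  have h0 : extNodes β 0 ≤ t := extNodes_zero.trans_le ht.1
  set j := Nat.findGreatest (fun j => extNodes β j ≤ t) (N - m)
  have hj : extNodes β j ≤ t :=
    Nat.findGreatest_spec (P := fun j => extNodes β j ≤ t) (Nat.zero_le _) h0
  have hjN : j ≤ N - m := Nat.findGreatest_le _
  refine ⟨j, by omega, hj, ?_⟩
  rcases hjN.eq_or_lt with h | h
  · rw [extNodes_of_lt (by omega)]
    exact ht.2
  · have h1 : ¬ extNodes β (j + 1) ≤ t :=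
      Nat.findGreatest_is_greatest (P := fun j => extNodes β j ≤ t) (Nat.lt_succ_self _) h
    exact (not_le.1 h1).le.trans (extNodes_mono hmono hβ (by omega))

/-- If every block of `r` consecutive nodes meets `F`, a function small on `F` is uniformly
small, up to its curvature energy. -/
theorem sq_le_of_forall_block (hmono : StrictMono β) (hβ : ∀ n, β n ∈ Set.Ioo (-1 : ℝ) 1)
    {B : ℝ} (hB : 0 < B) (hd : dMax β / dMin β ≤ B) {F : Finset (Fin N)} {r : ℕ} (hr : 1 ≤ r)
    (hrN : 2 * r ≤ N)
    (hblock : ∀ i, i + r ≤ N → ∃ n ∈ F, i ≤ (n : ℕ) ∧ (n : ℕ) < i + r)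
    {e e1 e2 : ℝ → ℝ} (he : HasSqIntegrableSecondDeriv e e1 e2) {G : ℝ}
    (hnode : ∀ v ∈ F, e (β v) ^ 2 ≤ G / N ^ 3)
    (hE : ∫ t in Set.Icc (-1 : ℝ) 1, e2 t ^ 2 ≤ 4 * G) {t : ℝ} (ht : t ∈ Set.Icc (-1 : ℝ) 1) :
    e t ^ 2 ≤ (2 * (1 + 2 * B) ^ 2 + 2048 * B ^ 3) * ((2 * r + 1) ^ 3 / N ^ 3) * G := by
  obtain ⟨j, hjN, hjt, htj⟩ := exists_extNodes_window hmono hβ hrN ht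
  obtain ⟨a, haF, ha1, ha2⟩ := hblock j (by omega)
  obtain ⟨b, hbF, hb1, hb2⟩ := hblock (j + r) (by omega)
  have hext := extNodes_mono hmono hβ
  have hN2 : 2 ≤ N := by omega
  have hNpos : (0 : ℝ) < N := by exact_mod_cast (by omega : 0 < N)
  have hE0 : 0 ≤ ∫ t in Set.Icc (-1 : ℝ) 1, e2 t ^ 2 := integral_nonneg fun x => sq_nonneg _
  have hG : 0 ≤ G := by linarith
  have hdpos := dMin_pos hmono hβ hN2
  have hdle := dMin_le hβ hN2
  have hdd : dMax β ≤ B * dMin β := (div_le_iff₀ hdpos).1 hd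
  set d := dMin β
  set m : ℝ := 2 * r + 1 with hm
  have hm1 : 1 ≤ m := by rw [hm]; linarith [(Nat.cast_nonneg r : (0 : ℝ) ≤ r)]
  set H := m * (B * d) with hH
  have hH0 : 0 ≤ H := by positivity
  have hlen : extNodes β (j + 2 * r + 1) - extNodes β j ≤ H := by
    have h := extNodes_add_sub_le (β := β) j (k := 2 * r + 1) (by omega)
    push_cast at h
    rw [add_assoc]
    exact h.trans (mul_le_mul_of_nonneg_left hdd (by positivity))
  have hX : ∀ v ∈ F, |e (β v)| ≤ √(G / N ^ 3) := fun v hv => Real.abs_le_sqrt (hnode v hv)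
  have hmain := he.abs_le_of_two_points (P := extNodes β j) (Q := extNodes β (j + 2 * r + 1))
    (a := β a) (b := β b) (t := t) (X := √(G / N ^ 3)) (D := √(H * (4 * G))) (H := H) (d := d)
    (extNodes_zero.ge.trans (hext (Nat.zero_le j)))
    ((hext (by omega : j + 2 * r + 1 ≤ N + 1)).trans_eq (extNodes_of_lt (by omega)))
    ((hext (by omega : j ≤ a + 1)).trans_eq (extNodes_succ_fin a))
    ((extNodes_succ_fin b).ge.trans (hext (by omega)))
    hjt htj hdpos (dMin_le_sub hmono hβ (Fin.lt_def.2 (by omega))) hlen (hX a haF) (hX b hbF)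
    (Real.sqrt_nonneg _)
    (by rw [Real.sq_sqrt (by positivity)]; exact mul_le_mul_of_nonneg_left hE hH0)
  have hHd : 2 * H / d = 2 * (m * B) := by rw [hH]; field_simp
  rw [hHd] at hmain
  have hHN : H ≤ 4 * m * B / N := by
    calc H = m * B * d := by rw [hH]; ring
      _ ≤ m * B * (4 / N) := by gcongr
      _ = _ := by ring
  have hfac : 1 + 2 * (m * B) ≤ m * (1 + 2 * B) := by linarith
  calc e t ^ 2 = |e t| ^ 2 := (sq_abs _).symm
    _ ≤ (√(G / N ^ 3) * (1 + 2 * (m * B)) + 2 * √(H * (4 * G)) * H) ^ 2 := by gcongr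
    _ ≤ 2 * (√(G / N ^ 3) * (1 + 2 * (m * B))) ^ 2 + 2 * (2 * √(H * (4 * G)) * H) ^ 2 := by
      linarith [sq_nonneg (√(G / N ^ 3) * (1 + 2 * (m * B)) - 2 * √(H * (4 * G)) * H)]
    _ = 2 * (G / N ^ 3) * (1 + 2 * (m * B)) ^ 2 + 32 * G * H ^ 3 := by
      rw [mul_pow, mul_pow, mul_pow, Real.sq_sqrt (by positivity), Real.sq_sqrt (by positivity)]
      ring
    _ ≤ 2 * (G / N ^ 3) * (m * (1 + 2 * B)) ^ 2 + 32 * G * (4 * m * B / N) ^ 3 := by gcongr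
    _ = (2 * (1 + 2 * B) ^ 2 * m ^ 2 + 2048 * B ^ 3 * m ^ 3) / N ^ 3 * G := by ring
    _ ≤ (2 * (1 + 2 * B) ^ 2 * m ^ 3 + 2048 * B ^ 3 * m ^ 3) / N ^ 3 * G := by
      have : m ^ 2 ≤ m ^ 3 := pow_le_pow_right₀ hm1 (by norm_num)
      gcongr
    _ = _ := by ring

end Nodes

section Stragglers

variable {p : ℝ}

theorem isProbabilityMeasure_bernoulliMeasure (hp : p ∈ Set.Ioo (0 : ℝ) 1) :
    IsProbabilityMeasure (bernoulliMeasure p) := by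
  constructor
  simp [bernoulliMeasure, ← ENNReal.ofReal_add hp.1.le (sub_nonneg.2 hp.2.le)]

theorem bernoulliMeasure_singleton_true : bernoulliMeasure p {true} = ENNReal.ofReal p := by
  simp [bernoulliMeasure]

theorem isProbabilityMeasure_stragglerMeasure (hp : p ∈ Set.Ioo (0 : ℝ) 1) (N : ℕ) :
    IsProbabilityMeasure (stragglerMeasure p N) := by
  have := isProbabilityMeasure_bernoulliMeasure hp
  unfold stragglerMeasure
  infer_instance

theorem stragglerMeasure_forall_mem_eq_true (hp : p ∈ Set.Ioo (0 : ℝ) 1) {N : ℕ}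
    (S : Finset (Fin N)) :
    stragglerMeasure p N {ω | ∀ n ∈ S, ω n = true} = ENNReal.ofReal p ^ S.card := by
  classical
  have := isProbabilityMeasure_bernoulliMeasure hp
  have hset : {ω : Fin N → Bool | ∀ n ∈ S, ω n = true} =
      Set.univ.pi fun n => if n ∈ S then {true} else Set.univ := by
    ext ω
    simp only [Set.mem_ofPred_eq, Set.mem_univ_pi]
    refine forall_congr' fun n => ?_
    by_cases h : n ∈ S <;> simp [h]
  rw [hset, stragglerMeasure, Measure.pi_pi, ← Finset.prod_const, ← Finset.prod_subset
    (Finset.subset_univ S) fun n _ hn => by rw [if_neg hn, measure_univ]]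
  exact Finset.prod_congr rfl fun n hn => by simp [hn, bernoulliMeasure_singleton_true]

/-- Union bound: with high probability there are no `r` consecutive stragglers. -/
theorem le_stragglerMeasure_forall_block (hp : p ∈ Set.Ioo (0 : ℝ) 1) {N r : ℕ} (hr : 1 ≤ r)
    {δ : ℝ} (hδ : N * p ^ r ≤ δ) :
    ENNReal.ofReal (1 - δ) ≤ stragglerMeasure p N
      {ω | ∀ i, i + r ≤ N → ∃ n ∈ nonStragglers ω, i ≤ (n : ℕ) ∧ (n : ℕ) < i + r} := by
  classical
  have := isProbabilityMeasure_stragglerMeasure hp N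
  set E := {ω : Fin N → Bool |
    ∀ i, i + r ≤ N → ∃ n ∈ nonStragglers ω, i ≤ (n : ℕ) ∧ (n : ℕ) < i + r} with hE
  let S : ℕ → Finset (Fin N) := fun i =>
    Finset.univ.filter fun n => i ≤ (n : ℕ) ∧ (n : ℕ) < i + r
  have hcard : ∀ i, i + r ≤ N → (S i).card = r := by
    intro i hi
    have h : (S i).map Fin.valEmbedding = Finset.Ico i (i + r) := by
      ext x
      simp only [S, Finset.mem_map, Finset.mem_filter, Finset.mem_univ, true_and,
        Fin.valEmbedding_apply, Finset.mem_Ico]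
      constructor
      · rintro ⟨n, hn, rfl⟩; exact hn
      · intro hx; exact ⟨⟨x, by omega⟩, hx, rfl⟩
    rw [← Finset.card_map Fin.valEmbedding, h, Nat.card_Ico]
    omega
  have hsub : Eᶜ ⊆ ⋃ i ∈ (Finset.range N).filter (fun i => i + r ≤ N),
      {ω : Fin N → Bool | ∀ n ∈ S i, ω n = true} := by
    intro ω hω
    simp only [hE, Set.mem_compl_iff, Set.mem_ofPred_eq, not_forall, not_exists, not_and] at hω
    obtain ⟨i, hi, hn⟩ := hω
    simp only [Set.mem_iUnion, Set.mem_ofPred_eq, Finset.mem_filter, Finset.mem_range]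
    refine ⟨i, ⟨by omega, hi⟩, fun n hnS => ?_⟩
    simp only [S, Finset.mem_filter, Finset.mem_univ, true_and] at hnS
    by_contra hne
    exact hn n (by simpa [nonStragglers] using hne) hnS.1 hnS.2
  have hcompl : stragglerMeasure p N Eᶜ ≤ ENNReal.ofReal δ := by
    calc stragglerMeasure p N Eᶜ
        ≤ ∑ i ∈ (Finset.range N).filter (fun i => i + r ≤ N),
            stragglerMeasure p N {ω | ∀ n ∈ S i, ω n = true} :=
          (measure_mono hsub).trans (measure_biUnion_finset_le _ _)
      _ = ∑ i ∈ (Finset.range N).filter (fun i => i + r ≤ N), ENNReal.ofReal p ^ r :=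
          Finset.sum_congr rfl fun i hi => by
            rw [stragglerMeasure_forall_mem_eq_true hp, hcard i (Finset.mem_filter.1 hi).2]
      _ ≤ N * ENNReal.ofReal p ^ r := by
          rw [Finset.sum_const, nsmul_eq_mul]
          gcongr
          exact (Finset.card_filter_le _ _).trans_eq (Finset.card_range N)
      _ = ENNReal.ofReal (N * p ^ r) := by
          rw [ENNReal.ofReal_mul (Nat.cast_nonneg N), ENNReal.ofReal_pow hp.1.le,
            ENNReal.ofReal_natCast]
      _ ≤ ENNReal.ofReal δ := ENNReal.ofReal_le_ofReal hδ
  have hδ0 : 0 ≤ δ := le_trans (by have := hp.1; positivity) hδ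
  rw [prob_compl_eq_one_sub (Set.toFinite E).measurableSet] at hcompl
  rw [ENNReal.ofReal_sub _ hδ0, ENNReal.ofReal_one]
  exact tsub_le_iff_tsub_le.1 hcompl

/-- For large `N` there is a block length of logarithmic order that rules out, with high
probability, a straggling block. -/
theorem exists_block_length (hp : p ∈ Set.Ioo (0 : ℝ) 1) {δ : ℝ} (hδ : δ ∈ Set.Ioo (0 : ℝ) 1) :
    ∃ n0 : ℕ, ∀ N : ℕ, n0 < N → ∃ r : ℕ, 1 ≤ r ∧ 2 * r ≤ N ∧ N * p ^ r ≤ δ ∧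
      (r : ℝ) ≤ 3 * (Real.logb (1 / p) ((1 - p) * N) + √(1 / δ)) := by
  have hp0 := hp.1
  have hq : 0 < 1 - p := sub_pos.2 hp.2
  have hb : 1 < 1 / p := (one_lt_div hp0).2 hp.2
  have hlogb : 0 < Real.log (1 / p) := Real.log_pos hb
  have hlim : Filter.Tendsto (fun N : ℕ => (1 - p) * (N : ℝ)) Filter.atTop Filter.atTop :=
    tendsto_natCast_atTop_atTop.const_mul_atTop hq
  have hc : 0 < Real.log (1 / p) / (8 * (1 - p)) := by positivity
  have h1 := hlim.eventually (Real.isLittleO_log_id_atTop.def hc)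
  have h2 := hlim.eventually (Filter.eventually_gt_atTop 1)
  have h3 := hlim.eventually (Filter.eventually_ge_atTop (1 / ((1 - p) * δ)))
  have h4 := Filter.eventually_ge_atTop (4 : ℕ)
  obtain ⟨n0, hn0⟩ := Filter.eventually_atTop.1 (h1.and (h2.and (h3.and h4)))
  refine ⟨n0, fun N hN => ?_⟩
  obtain ⟨h1, h2, h3, h4⟩ := hn0 N hN.le
  have hδ0 := hδ.1
  set M := (1 - p) * (N : ℝ) with hM
  have hM0 : 0 < M := by linarith
  have hN4 : (4 : ℝ) ≤ N := by exact_mod_cast h4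
  set L := Real.logb (1 / p) M with hL
  have hL0 : 0 < L := Real.logb_pos hb h2
  have hsq : 1 ≤ √(1 / δ) := by
    rw [Real.one_le_sqrt]
    exact (one_lt_one_div hδ.1 hδ.2).le
  have hceil : (⌈2 * L⌉₊ : ℝ) < 2 * L + 1 := Nat.ceil_lt_add_one (by positivity)
  refine ⟨⌈2 * L⌉₊, Nat.one_le_iff_ne_zero.2 (Nat.ceil_pos.2 (by positivity)).ne', ?_, ?_,
    by linarith⟩
  · have hlogM : Real.log M ≤ Real.log (1 / p) * (N / 8) := by
      rw [Real.norm_eq_abs, abs_of_pos (Real.log_pos h2), id, Real.norm_eq_abs,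
        abs_of_pos hM0] at h1
      refine h1.trans (le_of_eq ?_)
      rw [hM]; field_simp
    have hLN : L ≤ N / 8 := by
      rw [hL, Real.logb, div_le_iff₀ hlogb]; linarith
    have : (2 * (⌈2 * L⌉₊ : ℝ)) ≤ N := by linarith
    exact_mod_cast this
  · have hpow : p ^ ⌈2 * L⌉₊ ≤ (M ^ 2)⁻¹ := by
      have hpL : p ^ L = M⁻¹ := by
        have h := Real.rpow_logb (one_div_pos.2 hp0) hb.ne' hM0
        rw [← hL, one_div, Real.inv_rpow hp0.le] at h
        rw [← h, inv_inv]
      calc p ^ ⌈2 * L⌉₊ = p ^ ((⌈2 * L⌉₊ : ℕ) : ℝ) := (Real.rpow_natCast _ _).symm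
        _ ≤ p ^ (L * 2) := Real.rpow_le_rpow_of_exponent_ge hp0 hp.2.le
          (by linarith [Nat.le_ceil (2 * L)])
        _ = (M ^ 2)⁻¹ := by rw [Real.rpow_mul hp0.le, hpL, Real.rpow_two, inv_pow]
    calc N * p ^ ⌈2 * L⌉₊ ≤ N * (M ^ 2)⁻¹ := by gcongr
      _ = 1 / ((1 - p) * M) := by rw [hM]; field_simp
      _ ≤ δ := by
        rw [div_le_iff₀ (by positivity)] at h3 ⊢
        linarith

end Stragglers

set_option maxHeartbeats 1000000 in
/-- **Theorem 1 (LeTCC under probabilistic stragglers).** -/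
theorem letcc_probabilistic_stragglers
    (p : ℝ) (hp : p ∈ Set.Ioo (0 : ℝ) 1) (B ν η δ : ℝ)
    (hB : 0 < B) (hν : 0 < ν) (hη : 0 < η) (hδ : δ ∈ Set.Ioo (0 : ℝ) 1) :
    ∃ Cl : ℝ, 0 < Cl ∧ ∃ n0 : ℕ, ∀ N : ℕ, n0 < N →
      ∀ β : Fin N → ℝ, StrictMono β → (∀ n, β n ∈ Set.Ioo (-1 : ℝ) 1) →
        dMax β / dMin β ≤ B →
      ∀ K : ℕ, 0 < K →
      ∀ α : Fin K → ℝ, StrictMono α → (∀ k, α k ∈ Set.Ioo (-1 : ℝ) 1) →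
      ∀ x : Fin K → ℝ,
      ∀ f : ℝ → ℝ,
        (∀ a b : ℝ, |f a - f b| ≤ ν * |a - b|) →
        (∀ t, DifferentiableAt ℝ f t) →
        (∀ t, DifferentiableAt ℝ (deriv f) t) →
        (∀ t, |deriv (deriv f) t| ≤ η) →
      ∀ uenc : ℝ → ℝ, ContDiffOn ℝ 2 uenc (Set.Icc (-1 : ℝ) 1) →
      ∀ lam : ℝ, 0 < lam → lam ≤ ((N : ℝ) ^ 4)⁻¹ →
      ∀ udec : (Fin N → Bool) → ℝ → ℝ,
        (∀ ω, (nonStragglers ω).Nonempty →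
          IsSmoothingSpline (nonStragglers ω) β (fun v => f (uenc (β v))) lam (udec ω)) →
      stragglerMeasure p N
        {ω | (nonStragglers ω).Nonempty ∧
          (1 / (K : ℝ)) * ∑ k, (udec ω (α k) - f (x k)) ^ 2 ≤
            Cl * ((Real.logb (1 / p) ((1 - p) * N) + Real.sqrt (1 / δ)) ^ 3 / (N : ℝ) ^ 3) *
              (∫ t in Set.Icc (-1 : ℝ) 1,
                (iteratedDerivWithin 2 (fun s => f (uenc s)) (Set.Icc (-1 : ℝ) 1) t) ^ 2) +
            (2 * ν ^ 2 / (K : ℝ)) * ∑ k, (uenc (α k) - x k) ^ 2} ≥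
        ENNReal.ofReal (1 - δ) := by
  obtain ⟨n0, hn0⟩ := exists_block_length hp hδ
  obtain ⟨C, hCB⟩ : ∃ C, C = 2 * (1 + 2 * B) ^ 2 + 2048 * B ^ 3 := ⟨_, rfl⟩
  have hC : 0 < C := by rw [hCB]; positivity
  refine ⟨1458 * C, by positivity, n0, ?_⟩
  intro N hN β hmono hβ hd K hK α _ hα x f hLip hf hf' hf'' uenc huenc lam hlam hlamN udec hudec
  obtain ⟨r, hr, hrN, hprob, hrL⟩ := hn0 N hN
  obtain ⟨g1, g2, hg⟩ := HasSqIntegrableSecondDeriv.comp huenc hf hf' hf''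
  refine (le_stragglerMeasure_forall_block hp hr hprob).trans (measure_mono fun ω hω => ?_)
  have hF : (nonStragglers ω).Nonempty := by
    obtain ⟨n, hn, -⟩ := hω 0 (by omega)
    exact ⟨n, hn⟩
  refine ⟨hF, ?_⟩
  rw [hg.setIntegral_iteratedDerivWithin_sq]
  obtain ⟨hnode, e1, e2, he, hE⟩ := hg.smoothingSpline_error hF hβ hlam (hudec ω hF)
  set G := ∫ t in Set.Icc (-1 : ℝ) 1, g2 t ^ 2
  set L := Real.logb (1 / p) ((1 - p) * N) + √(1 / δ)
  have hG : 0 ≤ G := integral_nonneg fun t => sq_nonneg _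
  have hNpos : (0 : ℝ) < N := by exact_mod_cast (by omega : 0 < N)
  have hKpos : (0 : ℝ) < K := by exact_mod_cast hK
  have hr1 : (1 : ℝ) ≤ r := by exact_mod_cast hr
  have hnode' : ∀ v ∈ nonStragglers ω, (udec ω (β v) - f (uenc (β v))) ^ 2 ≤ G / N ^ 3 := by
    intro v hv
    refine (hnode v hv).trans ?_
    calc N * lam * G ≤ N * ((N : ℝ) ^ 4)⁻¹ * G := by gcongr
      _ = G / N ^ 3 := by field_simp
  have hpt : ∀ k, (udec ω (α k) - f (x k)) ^ 2 ≤
      1458 * C * (L ^ 3 / N ^ 3) * G + 2 * ν ^ 2 * (uenc (α k) - x k) ^ 2 := by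
    intro k
    have h1 := sq_le_of_forall_block hmono hβ hB hd hr hrN hω he hnode' hE
      (Set.Ioo_subset_Icc_self (hα k))
    rw [← hCB] at h1
    have h2 : (f (uenc (α k)) - f (x k)) ^ 2 ≤ ν ^ 2 * (uenc (α k) - x k) ^ 2 := by
      rw [← mul_pow, ← sq_abs, ← sq_abs (ν * _), abs_mul, abs_of_pos hν]
      gcongr
      exact hLip _ _
    have h3 : C * ((2 * (r : ℝ) + 1) ^ 3 / N ^ 3) * G ≤ C * ((9 * L) ^ 3 / N ^ 3) * G := by
      gcongr
      linarith
    have h4 : C * ((9 * L) ^ 3 / N ^ 3) * G = 729 * C * (L ^ 3 / N ^ 3) * G := by ring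
    linarith [sq_nonneg ((udec ω (α k) - f (uenc (α k))) - (f (uenc (α k)) - f (x k)))]
  calc (1 / (K : ℝ)) * ∑ k, (udec ω (α k) - f (x k)) ^ 2
      ≤ (1 / (K : ℝ)) * ∑ k, (1458 * C * (L ^ 3 / N ^ 3) * G +
          2 * ν ^ 2 * (uenc (α k) - x k) ^ 2) := by
        gcongr with k
        exact hpt k
    _ = 1458 * C * (L ^ 3 / N ^ 3) * G + (2 * ν ^ 2 / (K : ℝ)) * ∑ k, (uenc (α k) - x k) ^ 2 := by
        rw [Finset.sum_add_distrib, Finset.sum_const, Finset.card_univ, Fintype.card_fin,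
          nsmul_eq_mul, ← Finset.mul_sum]
        field_simp
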